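/- Let D be a byte pair dictionary and u⌢v a rule of D. There exists a string w such that the rule u⌢v is applied at some step of the HuggingFace derivation producing 𝕋_hf^D(w) if and only if u⌢v is applied at some step of the HuggingFace derivation producing 𝕋_hf^D(uv). -/

import Mathlib

/-!
Formalization of byte pair encoding (BPE) tokenization semantics.

* The alphabet is a type `α`.
* A *token* is a (intended nonempty) string over `α`, i.e. a `List α`.
* A *tokenization* is a finite sequence of tokens.
* A *byte pair dictionary* is a finite sequence of rules (pairs of tokens),
  listed in order of decreasing priority.
-/

/-- A token: a string over the alphabet `α`. -/
abbrev Token (α : Type*) := List α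

/-- A tokenization: a finite sequence of tokens. -/
abbrev Tok (α : Type*) := List (Token α)

/-- A byte pair dictionary: a finite sequence of rules, in decreasing priority order. -/
abbrev Dict (α : Type*) := List (Token α × Token α)

variable {α : Type*}

/-- `π`: concatenation of the tokens of a tokenization. -/
def pi (τ : Tok α) : List α := τ.flatten

/-- All tokens of a tokenization are nonempty strings. -/
def NETok (τ : Tok α) : Prop := ∀ u ∈ τ, u ≠ []

/-- All rules of a dictionary consist of nonempty tokens. -/
def NEDict (D : Dict α) : Prop := ∀ r ∈ D, r.1 ≠ [] ∧ r.2 ≠ []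

/-- `Tk∅(w)`: the initial tokenization of `w` into single symbols. -/
def TkEmpty (w : List α) : Tok α := w.map (fun a => [a])

/-- Rule `r` applies in tokenization `τ` at position `p`
(i.e. `τ = φ ⌢ r.1 ⌢ r.2 ⌢ φ'` with `|φ| = p`). -/
def AppliesAt (r : Token α × Token α) (τ : Tok α) (p : ℕ) : Prop :=
  ∃ φ φ' : Tok α, φ.length = p ∧ τ = φ ++ r.1 :: r.2 :: φ'

/-- Rule `r` applies somewhere in tokenization `τ`. -/
def Applies (r : Token α × Token α) (τ : Tok α) : Prop := ∃ p, AppliesAt r τ p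

/-- The result of applying (merging by) rule `r` at position `p` in `τ`. -/
def applyAt (r : Token α × Token α) (τ : Tok α) (p : ℕ) : Tok α :=
  τ.take p ++ (r.1 ++ r.2) :: τ.drop (p + 2)

/-- The base (nondeterministic) rewriting step `τ ⇒ τ'`: some rule of `D`
is applied somewhere in `τ`. -/
def BStep (D : Dict α) (τ τ' : Tok α) : Prop :=
  ∃ (φ φ' : Tok α) (u v : Token α),
    (u, v) ∈ D ∧ τ = φ ++ u :: v :: φ' ∧ τ' = φ ++ (u ++ v) :: φ'

/-- `τ` is a base tokenization of `w`: reachable from `Tk∅(w)` by base steps,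
and no rule of `D` applies to it. -/
def IsBase (D : Dict α) (w : List α) (τ : Tok α) : Prop :=
  Relation.ReflTransGen (BStep D) (TkEmpty w) τ ∧ ∀ τ', ¬ BStep D τ τ'

/-- `BStepN D n τ τ'`: `τ'` is obtained from `τ` by exactly `n` base steps. -/
def BStepN (D : Dict α) : ℕ → Tok α → Tok α → Prop
  | 0 => Eq
  | n + 1 => fun τ τ'' => ∃ τ', BStepN D n τ τ' ∧ BStep D τ' τ''

/-- One SentencePiece step applying the rule of index `i` (highest priority
applicable) at position `p` (leftmost occurrence of that rule). -/
def SPStepAt (D : Dict α) (i p : ℕ) (τ τ' : Tok α) : Prop :=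
  ∃ h : i < D.length,
    AppliesAt (D[i]'h) τ p ∧
    (∀ (j : ℕ) (hj : j < D.length), j < i → ¬ Applies (D[j]'hj) τ) ∧
    (∀ q < p, ¬ AppliesAt (D[i]'h) τ q) ∧
    τ' = applyAt (D[i]'h) τ p

/-- One SentencePiece step: the highest priority applicable rule is applied
at its leftmost occurrence. -/
def SPStep (D : Dict α) (τ τ' : Tok α) : Prop := ∃ i p, SPStepAt D i p τ τ'

/-- One SentencePiece step which applies the rule `r` of `D`. -/
def SPStepRule (D : Dict α) (r : Token α × Token α) (τ τ' : Tok α) : Prop :=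
  ∃ (i p : ℕ) (h : i < D.length), D[i]'h = r ∧ SPStepAt D i p τ τ'

/-- `τ` is the SentencePiece tokenization `𝕋^D(w)` of `w`: reachable from
`Tk∅(w)` by SentencePiece steps, and no further step applies. -/
def IsSP (D : Dict α) (w : List α) (τ : Tok α) : Prop :=
  Relation.ReflTransGen (SPStep D) (TkEmpty w) τ ∧ ∀ τ', ¬ SPStep D τ τ'

/-- One application of rule `r` at its leftmost occurrence. -/
def LeftStep (r : Token α × Token α) (τ τ' : Tok α) : Prop :=
  ∃ p, AppliesAt r τ p ∧ (∀ q < p, ¬ AppliesAt r τ q) ∧ τ' = applyAt r τ p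

/-- Exhaustive application of rule `r`, leftmost first, until it no longer applies. -/
def Exhaust (r : Token α × Token α) (τ τ' : Tok α) : Prop :=
  Relation.ReflTransGen (LeftStep r) τ τ' ∧ ¬ Applies r τ'

/-- One HuggingFace (macro) step using the rule of index `i`: the rule of
index `i` is the highest-priority applicable rule, and it is applied
repeatedly at its leftmost occurrence until it no longer applies. -/
def HFStepAt (D : Dict α) (i : ℕ) (τ τ' : Tok α) : Prop :=
  ∃ h : i < D.length,
    Applies (D[i]'h) τ ∧
    (∀ (j : ℕ) (hj : j < D.length), j < i → ¬ Applies (D[j]'hj) τ) ∧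
    Exhaust (D[i]'h) τ τ'

/-- One HuggingFace (macro) step. -/
def HFStep (D : Dict α) (τ τ' : Tok α) : Prop := ∃ i, HFStepAt D i τ τ'

/-- One HuggingFace (macro) step which uses the rule `r` of `D`. -/
def HFStepRule (D : Dict α) (r : Token α × Token α) (τ τ' : Tok α) : Prop :=
  ∃ (i : ℕ) (h : i < D.length), D[i]'h = r ∧ HFStepAt D i τ τ'

/-- `τ` is the HuggingFace tokenization `𝕋_hf^D(w)` of `w`. -/
def IsHF (D : Dict α) (w : List α) (τ : Tok α) : Prop :=
  Relation.ReflTransGen (HFStep D) (TkEmpty w) τ ∧ ∀ τ', ¬ HFStep D τ τ'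

/-- A dictionary is *proper* if each side of each rule of length `> 1` is
produced by some higher-priority rule. -/
def Proper (D : Dict α) : Prop :=
  ∀ (j : ℕ) (hj : j < D.length),
    (1 < (D[j]'hj).1.length →
      ∃ (i : ℕ) (hi : i < D.length), i < j ∧ (D[j]'hj).1 = (D[i]'hi).1 ++ (D[i]'hi).2) ∧
    (1 < (D[j]'hj).2.length →
      ∃ (i : ℕ) (hi : i < D.length), i < j ∧ (D[j]'hj).2 = (D[i]'hi).1 ++ (D[i]'hi).2)

/-- `max{|uv| : u⌢v ∈ D}`: the maximal total length of a rule of `D`. -/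
def maxPairLen (D : Dict α) : ℕ := (D.map (fun r => (r.1 ++ r.2).length)).foldr max 0

/-- `l` is a sufficient lookahead bound for `D`: whenever `𝕋^D(π(φ)π(τ)) = φ⌢τ` with
`|π(τ)| ≥ l`, appending any further text keeps `φ` as a prefix of the tokenization. -/
def GoodLookahead (D : Dict α) (l : ℕ) : Prop :=
  ∀ φ τ ψ : Tok α, l ≤ (pi τ).length →
    IsSP D (pi φ ++ pi τ) (φ ++ τ) →
    ∃ ψ', IsSP D (pi φ ++ pi τ ++ pi ψ) (φ ++ ψ')

/-- The lookahead constant `l(D)`: the smallest sufficient lookahead bound. -/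
noncomputable def lookaheadConst (D : Dict α) : ℕ := sInf {l | GoodLookahead D l}

/-- The rule `r` gets applied at some step of the HuggingFace derivation
producing `𝕋_hf^D(w)`. -/
def HFUses (D : Dict α) (r : Token α × Token α) (w : List α) : Prop :=
  ∃ τ τ' : Tok α, Relation.ReflTransGen (HFStep D) (TkEmpty w) τ ∧ HFStepRule D r τ τ'

theorem append_eq_append_cons_cases {β : Type*} {P Q φ φ' : List β} {x : β}
    (h : P ++ Q = φ ++ x :: φ') :
    (∃ Y, P = φ ++ x :: Y ∧ φ' = Y ++ Q) ∨ ∃ X, φ = P ++ X ∧ Q = X ++ x :: φ' := by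
  rcases List.append_eq_append_iff.1 h with ⟨X, rfl, hX⟩ | ⟨X, rfl, hX⟩
  · exact .inr ⟨X, rfl, hX⟩
  · rcases List.cons_eq_append_iff.1 hX with ⟨rfl, rfl⟩ | ⟨Y, rfl, rfl⟩
    · exact .inr ⟨[], by simp, by simp⟩
    · exact .inl ⟨Y, rfl, rfl⟩

theorem AppliesAt.append_context {r : Token α × Token α} {B : Tok α} {p : ℕ}
    (h : AppliesAt r B p) (A C : Tok α) : AppliesAt r (A ++ B ++ C) (A.length + p) := by
  obtain ⟨φ, φ', rfl, rfl⟩ := h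
  exact ⟨A ++ φ, φ' ++ C, by simp, by simp⟩

theorem Applies.append_context {r : Token α × Token α} {B : Tok α}
    (h : Applies r B) (A C : Tok α) : Applies r (A ++ B ++ C) :=
  h.elim fun _ hp => ⟨_, hp.append_context A C⟩

theorem applyAt_append_cons_cons (r : Token α × Token α) (φ φ' : Tok α) :
    applyAt r (φ ++ r.1 :: r.2 :: φ') φ.length = φ ++ (r.1 ++ r.2) :: φ' := by
  simp [applyAt, List.drop_append]

theorem LeftStep.applies {r : Token α × Token α} {τ τ' : Tok α} (h : LeftStep r τ τ') :
    Applies r τ :=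
  h.elim fun p hp => ⟨p, hp.1⟩

theorem LeftStep.pi_eq {r : Token α × Token α} {τ τ' : Tok α} (h : LeftStep r τ τ') :
    pi τ = pi τ' := by
  obtain ⟨_, ⟨φ, φ', rfl, rfl⟩, -, rfl⟩ := h
  simp [applyAt_append_cons_cons, pi]

theorem pi_eq_of_leftSteps {r : Token α × Token α} {τ τ' : Tok α}
    (h : Relation.ReflTransGen (LeftStep r) τ τ') : pi τ = pi τ' := by
  induction h with
  | refl => rfl
  | tail _ h ih => exact ih.trans h.pi_eq

theorem HFStep.pi_eq {D : Dict α} {τ τ' : Tok α} (h : HFStep D τ τ') : pi τ = pi τ' := by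
  obtain ⟨_, _, _, _, h, _⟩ := h
  exact pi_eq_of_leftSteps h

theorem pi_eq_of_hfSteps {D : Dict α} {τ τ' : Tok α}
    (h : Relation.ReflTransGen (HFStep D) τ τ') : pi τ = pi τ' := by
  induction h with
  | refl => rfl
  | tail _ h ih => exact ih.trans h.pi_eq

/-- A leftmost application restricts to every factor of its result. -/
theorem LeftStep.exists_factor {r : Token α × Token α} {τ A' B' C' : Tok α}
    (h : LeftStep r τ (A' ++ B' ++ C')) :
    ∃ A B C, τ = A ++ B ++ C ∧ Relation.ReflTransGen (LeftStep r) B B' := by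
  obtain ⟨_, ⟨φ, φ', rfl, rfl⟩, hleft, h⟩ := h
  rw [applyAt_append_cons_cons] at h
  rcases append_eq_append_cons_cases h with ⟨Y, hY, rfl⟩ | ⟨X, rfl, rfl⟩
  · rcases append_eq_append_cons_cases hY with ⟨Z, rfl, rfl⟩ | ⟨X, rfl, rfl⟩
    · exact ⟨φ ++ r.1 :: r.2 :: Z, B', C', by simp, .refl⟩
    · refine ⟨A', X ++ r.1 :: r.2 :: Y, C', by simp,
        .single ⟨X.length, ⟨X, Y, rfl, rfl⟩, fun q hq hX => ?_,
          (applyAt_append_cons_cons r X Y).symm⟩⟩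
      refine hleft (A'.length + q) (by simpa using hq) ?_
      simpa using hX.append_context A' C'
  · exact ⟨A', B', X ++ r.1 :: r.2 :: φ', by simp, .refl⟩

theorem exists_factor_of_leftSteps {r : Token α × Token α} {τ τ' : Tok α}
    (h : Relation.ReflTransGen (LeftStep r) τ τ') {A' B' C' : Tok α}
    (hτ' : τ' = A' ++ B' ++ C') :
    ∃ A B C, τ = A ++ B ++ C ∧ Relation.ReflTransGen (LeftStep r) B B' := by
  induction h using Relation.ReflTransGen.head_induction_on with
  | refl => exact ⟨A', B', C', hτ', .refl⟩
  | head h _ ih =>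
    obtain ⟨A, B, C, rfl, hB⟩ := ih
    obtain ⟨A₀, B₀, C₀, rfl, hB₀⟩ := h.exists_factor
    exact ⟨A₀, B₀, C₀, rfl, hB₀.trans hB⟩

theorem Exhaust.exists_factor {r : Token α × Token α} {τ A' B' C' : Tok α}
    (h : Exhaust r τ (A' ++ B' ++ C')) :
    ∃ A B C, τ = A ++ B ++ C ∧ Exhaust r B B' := by
  obtain ⟨A, B, C, hτ, hB⟩ := exists_factor_of_leftSteps h.1 rfl
  exact ⟨A, B, C, hτ, hB, fun hr => h.2 (hr.append_context A' C')⟩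

theorem Exhaust.eq_of_not_applies {r : Token α × Token α} {τ τ' : Tok α}
    (h : Exhaust r τ τ') (hr : ¬ Applies r τ) : τ = τ' := by
  rcases h.1.cases_head with h | ⟨_, h, _⟩
  · exact h
  · exact absurd h.applies hr

/-- A HuggingFace step restricts to every factor of its result. -/
theorem HFStep.exists_factor {D : Dict α} {τ A' B' C' : Tok α}
    (h : HFStep D τ (A' ++ B' ++ C')) :
    ∃ A B C, τ = A ++ B ++ C ∧ Relation.ReflTransGen (HFStep D) B B' := by
  obtain ⟨i, hi, _, hmin, hex⟩ := h
  obtain ⟨A, B, C, rfl, hB⟩ := hex.exists_factor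
  refine ⟨A, B, C, rfl, ?_⟩
  by_cases hr : Applies D[i] B
  · exact .single ⟨i, hi, hr, fun j hj hji hjB => hmin j hj hji (hjB.append_context A C), hB⟩
  · rw [hB.eq_of_not_applies hr]

theorem exists_factor_of_hfSteps {D : Dict α} {τ τ' : Tok α}
    (h : Relation.ReflTransGen (HFStep D) τ τ') {A' B' C' : Tok α}
    (hτ' : τ' = A' ++ B' ++ C') :
    ∃ A B C, τ = A ++ B ++ C ∧ Relation.ReflTransGen (HFStep D) B B' := by
  induction h using Relation.ReflTransGen.head_induction_on with
  | refl => exact ⟨A', B', C', hτ', .refl⟩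
  | head h _ ih =>
    obtain ⟨A, B, C, rfl, hB⟩ := ih
    obtain ⟨A₀, B₀, C₀, rfl, hB₀⟩ := h.exists_factor
    exact ⟨A₀, B₀, C₀, rfl, hB₀.trans hB⟩

theorem eq_tkEmpty_pi_of_factor {w : List α} {A B C : Tok α} (h : TkEmpty w = A ++ B ++ C) :
    B = TkEmpty (pi B) := by
  obtain ⟨l, _, _, h, _⟩ := List.map_eq_append_iff.1 h
  obtain ⟨_, b, _, _, rfl⟩ := List.map_eq_append_iff.1 h
  simp [pi, TkEmpty, ← List.flatMap_def]

theorem exhaust_pair (r : Token α × Token α) : Exhaust r [r.1, r.2] [r.1 ++ r.2] := by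
  refine ⟨.single ⟨0, ⟨[], [], rfl, rfl⟩, by simp, by simp [applyAt]⟩, ?_⟩
  rintro ⟨_, φ, φ', -, h⟩
  have := congrArg List.length h
  simp at this
  omega

/-- A rule `u⌢v` of `D` is applied in the HuggingFace derivation of
some string iff it is applied in the HuggingFace derivation of `uv`. -/
theorem hf_useful_iff (D : Dict α) (hD : NEDict D)
    (r : Token α × Token α) (hr : r ∈ D) :
    (∃ w : List α, HFUses D r w) ↔ HFUses D r (r.1 ++ r.2) := by
  refine ⟨?_, fun h => ⟨_, h⟩⟩
  rintro ⟨w, τ, τ', hw, i, hi, rfl, _, ⟨_, φ, φ', -, rfl⟩, hmin, -⟩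
  obtain ⟨A, B, C, hτ, hB⟩ := exists_factor_of_hfSteps hw
    (A' := φ) (B' := [D[i].1, D[i].2]) (C' := φ') (by simp)
  have hpi : pi B = D[i].1 ++ D[i].2 := by simpa [pi] using pi_eq_of_hfSteps hB
  rw [eq_tkEmpty_pi_of_factor hτ, hpi] at hB
  refine ⟨_, _, hB, i, hi, rfl, hi, ⟨0, [], [], rfl, rfl⟩, fun j hj hji hr => ?_, exhaust_pair _⟩
  exact hmin j hj hji (by simpa using hr.append_context φ φ')
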